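/- For every DPN state (M₀,α₀), every program-state/log pair (s,σ): if ⟦C_loop⟧(s_{M₀,α₀}, ε)(s,σ) > 0, then (1) σ ∈ Runs(M₀,α₀,𝒢), (2) s is observable, and (3) (M₀,α₀) —σ→ (M_s, α_s), where M_s(p) = s(p̲) and α_s(v) = s(v̲) are the marking and valuation decoded from s. -/

import Mathlib

open scoped ENNReal
open scoped Classical

noncomputable section

/-! ## Data Petri nets -/

/-- A Data Petri net over places `P`, transitions `T`, case variables `V` and
activity names `A`.  Pre- and postconditions are modelled semantically, together
with the (finite) sets of unprimed variables `readVars t` occurring in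
`pre(t) ∧ post(t)` and of primed variables `writeVars t` occurring in `post(t)`;
the conditions only depend on those variables. The data domain is `Δ = ℚ`. -/
structure DPN (P T V A : Type) where
  flowPT : P → T → Bool
  flowTP : T → P → Bool
  label : T → A
  readVars : T → Finset V
  writeVars : T → Finset V
  preCond : T → (V → ℚ) → Prop
  postCond : T → (V → ℚ) → (V → ℚ) → Prop
  pre_dep : ∀ t f g, (∀ v ∈ readVars t, f v = g v) → (preCond t f ↔ preCond t g)
  post_dep : ∀ t f g f' g', (∀ v ∈ readVars t, f v = g v) →
      (∀ v ∈ writeVars t, f' v = g' v) → (postCond t f f' ↔ postCond t g g')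

variable {P T V A : Type}

/-- A state `(M, α)` of a DPN: a marking and a valuation of the case variables. -/
abbrev NState (P V : Type) := (P → ℕ) × (V → ℚ)

/-- A step `(t, β)`: a transition together with a partial valuation `β`
(on the unprimed variables, `bu`, and on the primed variables, `bp`). -/
structure PStep (T V : Type) where
  tr : T
  bu : V → Option ℚ
  bp : V → Option ℚ

/-- Total extension of the unprimed part of `β`. -/
def PStep.totu (stp : PStep T V) : V → ℚ := fun v => (stp.bu v).getD 0

/-- Total extension of the primed part of `β`. -/
def PStep.totp (stp : PStep T V) : V → ℚ := fun v => (stp.bp v).getD 0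

/-- `β` is defined exactly on the variables of `pre(t)` and `post(t)` and agrees
with `α` on the unprimed variables. -/
def Matches (N : DPN P T V A) (α : V → ℚ) (stp : PStep T V) : Prop :=
  (∀ v, (stp.bu v).isSome ↔ v ∈ N.readVars stp.tr) ∧
  (∀ v, (stp.bp v).isSome ↔ v ∈ N.writeVars stp.tr) ∧
  (∀ v ∈ N.readVars stp.tr, stp.bu v = some (α v))

/-- The step `(t,β)` is enabled in `(M,α)`:  `(M,α)[(t,β)⟩`. -/
def Enabled (N : DPN P T V A) (st : NState P V) (stp : PStep T V) : Prop :=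
  Matches N st.2 stp ∧
  (∀ p, N.flowPT p stp.tr = true → 1 ≤ st.1 p) ∧
  N.preCond stp.tr stp.totu ∧
  N.postCond stp.tr stp.totu stp.totp

/-- The marking after firing `t`. -/
def fireM (N : DPN P T V A) (M : P → ℕ) (t : T) : P → ℕ :=
  fun p => M p - (if N.flowPT p t then 1 else 0) + (if N.flowTP t p then 1 else 0)

/-- The valuation after firing the step. -/
def fireV (N : DPN P T V A) (α : V → ℚ) (stp : PStep T V) : V → ℚ :=
  fun v => if v ∈ N.writeVars stp.tr then stp.totp v else α v

/-- `(M,α) —(t,β)→ (M',α')`. -/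
def Fires (N : DPN P T V A) (st : NState P V) (stp : PStep T V) (st' : NState P V) : Prop :=
  Enabled N st stp ∧ st' = (fireM N st.1 stp.tr, fireV N st.2 stp)

/-- `(M,α) —σ→ (M',α')` for a run `σ`. -/
def RunsTo (N : DPN P T V A) : NState P V → List (PStep T V) → NState P V → Prop
  | st, [], st' => st' = st
  | st, stp :: σ, st' => ∃ st1, Fires N st stp st1 ∧ RunsTo N st1 σ st'

/-- `σ ∈ Runs(M,α,𝒢)`: no proper nonempty prefix of `σ` fired from `(M,α)`
reaches a state in `G`. -/
def InRuns (N : DPN P T V A) (G : Set (NState P V)) (st : NState P V)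
    (σ : List (PStep T V)) : Prop :=
  ∀ k, 0 < k → k < σ.length → ∀ st', RunsTo N st (σ.take k) st' → st' ∉ G

/-! ## Schedulers and likelihoods -/

/-- A scheduler of a DPN: for every state, a probability distribution over the
transitions and, for every (primed) variable, a probability distribution over `ℚ`. -/
structure Scheduler [Fintype T] (N : DPN P T V A) where
  schT : NState P V → T → ℝ≥0∞
  schV : NState P V → V → ℚ → ℝ≥0∞
  schT_dist : ∀ st, ∑ t : T, schT st t = 1
  schV_dist : ∀ st v, ∑' q : ℚ, schV st v q = 1

variable [Fintype T]

/-- The set `enabled(M,α)` of transitions enabled in a state. -/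
def enabledSet (N : DPN P T V A) (st : NState P V) : Set T :=
  {t | ∃ stp : PStep T V, stp.tr = t ∧ Enabled N st stp}

/-- Iverson bracket, valued in `ℝ≥0∞`. -/
def ind (p : Prop) : ℝ≥0∞ := if p then 1 else 0

/-- `P_𝔖[M,α](t)`: the likelihood of selecting transition `t`. -/
def transLik (N : DPN P T V A) (S : Scheduler N) (st : NState P V) (t : T) : ℝ≥0∞ :=
  (ind (t ∈ enabledSet N st) * S.schT st t) /
    ∑ t' : T, ind (t' ∈ enabledSet N st) * S.schT st t'

/-- `P_𝔖[M,α](β | t)`: the likelihood of selecting valuation `β` given `t`. -/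
def valLik (N : DPN P T V A) (S : Scheduler N) (st : NState P V) (stp : PStep T V) : ℝ≥0∞ :=
  ind (N.postCond stp.tr stp.totu stp.totp) *
    ∏ v ∈ N.writeVars stp.tr, S.schV st v (stp.totp v)

/-- `P_𝔖[M,α](t,β)`: the step likelihood. -/
def stepLik (N : DPN P T V A) (S : Scheduler N) (st : NState P V) (stp : PStep T V) : ℝ≥0∞ :=
  transLik N S st stp.tr * valLik N S st stp

/-- `P_𝔖[M,α](σ ⊨ ◊𝒢)`: the likelihood that the run `σ` reaches `G` from `(M,α)`. -/
def runLik (N : DPN P T V A) (S : Scheduler N) (G : Set (NState P V)) :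
    List (PStep T V) → NState P V → ℝ≥0∞
  | [], st => ind (st ∈ G)
  | stp :: σ', st =>
      if st ∈ G then 1
      else if Enabled N st stp then
        stepLik N S st stp * runLik N S G σ' (fireM N st.1 stp.tr, fireV N st.2 stp)
      else 0

/-- `P_𝔖[M,α](σ | ◊𝒢)`: the probability that the run `σ` reaches `G`. -/
def runProb (N : DPN P T V A) (S : Scheduler N) (G : Set (NState P V))
    (st : NState P V) (σ : List (PStep T V)) : ℝ≥0∞ :=
  runLik N S G σ st / ∑' σ' : {σ' : List (PStep T V) // InRuns N G st σ'}, runLik N S G σ'.1 st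

/-! ## The probabilistic programming language PPL -/

mutual
/-- PPL commands over program variables `Var` and messages `Msg`.
Distribution expressions, Boolean expressions, probability expressions and
message expressions are modelled semantically as functions of the program state. -/
inductive Cmd (Var Msg : Type) : Type 1 where
  | assign : Var → ((Var → ℚ) → ℚ → ℝ≥0∞) → Cmd Var Msg
  | observe : ((Var → ℚ) → Prop) → Cmd Var Msg
  | log : ((Var → ℚ) → Msg) → Cmd Var Msg
  | seq : Cmd Var Msg → Cmd Var Msg → Cmd Var Msg
  | loop : GCmd Var Msg → Cmd Var Msg
  | iffi : GCmd Var Msg → Cmd Var Msg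
/-- PPL guarded commands. -/
inductive GCmd (Var Msg : Type) : Type 1 where
  | guard : ((Var → ℚ) → Prop) → ((Var → ℚ) → ℝ≥0∞) → Cmd Var Msg → GCmd Var Msg
  | choice : GCmd Var Msg → GCmd Var Msg → GCmd Var Msg
end

/-- Pairs of a program state and a program log. -/
abbrev PSL (Var Msg : Type) := ((Var → ℚ)) × List Msg

/-- Dirac distribution. -/
def dirac {X : Type*} (a : X) : X → ℝ≥0∞ := fun b => if b = a then 1 else 0

/-- Pointwise function update. -/
def upd {Var : Type} (s : Var → ℚ) (x : Var) (q : ℚ) : Var → ℚ :=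
  fun y => if y = x then q else s y

variable {Var Msg : Type}

/-- `done(GC)`: how many guards of `GC` hold. -/
def GCmd.done : GCmd Var Msg → (Var → ℚ) → ℝ≥0∞
  | .guard B _ _, s => ind (B s)
  | .choice g1 g2, s => g1.done s + g2.done s

/-- `branchProb(GC)`: total probability of the guards of `GC` that hold. -/
def GCmd.branchProb : GCmd Var Msg → (Var → ℚ) → ℝ≥0∞
  | .guard B E _, s => ind (B s) * E s
  | .choice g1 g2, s => g1.branchProb s + g2.branchProb s

/-- Finite unrollings of a loop:  `⟦C₀⟧ = 0` and
`⟦C_{n+1}⟧(s,ℓ) = (1 − done)·δ_{(s,ℓ)} + ⟦if GC fi; C_n⟧(s,ℓ)`, where `body`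
is the semantics of `if GC fi`. -/
def iter (done : (Var → ℚ) → ℝ≥0∞) (body : PSL Var Msg → PSL Var Msg → ℝ≥0∞) :
    ℕ → PSL Var Msg → PSL Var Msg → ℝ≥0∞
  | 0, _, _ => 0
  | n + 1, sl, out =>
      (1 - done sl.1) * dirac sl out + ∑' sl', body sl sl' * iter done body n sl' out

mutual
/-- The unnormalized semantics `⟦C⟧ : PSL → subdistributions over PSL`. -/
def sem : Cmd Var Msg → PSL Var Msg → PSL Var Msg → ℝ≥0∞
  | .assign x D, sl, out => ∑' q : ℚ, D sl.1 q * dirac (upd sl.1 x q, sl.2) out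
  | .observe B, sl, out => ind (B sl.1) * dirac sl out
  | .log m, sl, out => dirac (sl.1, sl.2 ++ [m sl.1]) out
  | .seq c1 c2, sl, out => ∑' sl', sem c1 sl sl' * sem c2 sl' out
  | .iffi gc, sl, out => (gc.done sl.1 / gc.branchProb sl.1) * semGC gc sl out
  | .loop gc, sl, out =>
      ⨆ n, iter gc.done
        (fun a b => (gc.done a.1 / gc.branchProb a.1) * semGC gc a b) n sl out
/-- The unnormalized semantics of guarded commands. -/
def semGC : GCmd Var Msg → PSL Var Msg → PSL Var Msg → ℝ≥0∞
  | .guard B E c, sl, out => ind (B sl.1) * E sl.1 * sem c sl out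
  | .choice g1 g2, sl, out => semGC g1 sl out + semGC g2 sl out
end

/-- The normalized semantics `⎣C⎦`. -/
def nsem (c : Cmd Var Msg) (sl : PSL Var Msg) : PSL Var Msg → ℝ≥0∞ :=
  fun out => sem c sl out / ∑' out', sem c sl out'

/-- The `n`-th finite unrolling of `do GC od`. -/
def unroll (gc : GCmd Var Msg) (n : ℕ) : PSL Var Msg → PSL Var Msg → ℝ≥0∞ :=
  iter gc.done (fun a b => (gc.done a.1 / gc.branchProb a.1) * semGC gc a b) n

/-! ## Encoding a DPN into PPL -/

/-- Program variables of the encoding: one variable `p̲` per place, and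
variables `v̲` (unprimed) and `v̲'` (primed) per case variable. -/
abbrev PVar (P V : Type) := P ⊕ (V ⊕ V)

/-- `p̲`. -/
def pl (p : P) : PVar P V := Sum.inl p
/-- `v̲`. -/
def unpr (v : V) : PVar P V := Sum.inr (Sum.inl v)
/-- `v̲'`. -/
def prm (v : V) : PVar P V := Sum.inr (Sum.inr v)

/-- `s_{M,α}`: the unique observable program state encoding `(M,α)`. -/
def obsState (st : NState P V) : PVar P V → ℚ
  | Sum.inl p => st.1 p
  | Sum.inr (Sum.inl v) => st.2 v
  | Sum.inr (Sum.inr v) => st.2 v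

/-- A program state is observable iff primed and unprimed variables agree. -/
def Observable (s : PVar P V → ℚ) : Prop := ∀ v : V, s (unpr v) = s (prm v)

/-- The marking `M_s` decoded from a program state. -/
def decodeM (s : PVar P V → ℚ) : P → ℕ := fun p => (⌊s (pl p)⌋).toNat

/-- The valuation `α_s` decoded from a program state. -/
def decodeV (s : PVar P V → ℚ) : V → ℚ := fun v => s (unpr v)

/-- The net state decoded from a program state. -/
def decodeSt (s : PVar P V → ℚ) : NState P V := (decodeM s, decodeV s)

/-- A skip command (observe true). -/
def skip : Cmd Var Msg := .observe (fun _ => True)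

/-- Sequential composition of a list of commands. -/
def seqAll (l : List (Cmd Var Msg)) : Cmd Var Msg := l.foldr .seq skip

/-- Deterministic assignment `x := E`: sample from the Dirac distribution on `E`. -/
def detAssign (x : Var) (E : (Var → ℚ) → ℚ) : Cmd Var Msg :=
  .assign x (fun s q => ind (q = E s))

variable [Fintype P] [Fintype V] [DecidableEq V]

/-- The preset `•t`, as a list. -/
def presetL (N : DPN P T V A) (t : T) : List P :=
  (Finset.univ.filter fun p => N.flowPT p t).toList

/-- The postset `t•`, as a list. -/
def postsetL (N : DPN P T V A) (t : T) : List P :=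
  (Finset.univ.filter fun p => N.flowTP t p).toList

/-- The message `step(t)`: the step `(t,β)` read off the current program state. -/
def getStep (N : DPN P T V A) (t : T) (s : PVar P V → ℚ) : PStep T V :=
  ⟨t, fun v => if v ∈ N.readVars t then some (s (unpr v)) else none,
      fun v => if v ∈ N.writeVars t then some (s (prm v)) else none⟩

/-- `⟨post(t)⟩`: the postcondition of `t` over the program variables. -/
def postExpr (N : DPN P T V A) (t : T) (s : PVar P V → ℚ) : Prop :=
  N.postCond t (fun v => s (unpr v)) (fun v => s (prm v))

/-- `B_enabled(t) = ⟨pre(t)⟩ ∧ ⋀_{p ∈ •t} p̲ ≥ 1`. -/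
def Benabled (N : DPN P T V A) (t : T) (s : PVar P V → ℚ) : Prop :=
  N.preCond t (fun v => s (unpr v)) ∧ ∀ p : P, N.flowPT p t = true → 1 ≤ s (pl p)

/-- `C_fire(t)`. -/
def Cfire (N : DPN P T V A) (S : Scheduler N) (t : T) : Cmd (PVar P V) (PStep T V) :=
  .seq (seqAll ((presetL N t).map fun p => detAssign (pl p) (fun s => s (pl p) - 1)))
  (.seq (seqAll ((postsetL N t).map fun p => detAssign (pl p) (fun s => s (pl p) + 1)))
  (.seq (seqAll ((N.writeVars t).toList.map fun v =>
          .assign (prm v) (fun s q => S.schV (decodeSt s) v q)))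
  (.seq (.observe (postExpr N t))
  (.seq (.log (getStep N t))
        (seqAll ((N.writeVars t).toList.map fun v =>
          detAssign (unpr v) (fun s => s (prm v))))))))

/-- One branch of the main loop's guarded command. -/
def branch (N : DPN P T V A) (S : Scheduler N) (G : Set (NState P V)) (t : T) :
    GCmd (PVar P V) (PStep T V) :=
  .guard (fun s => decodeSt s ∉ G ∧ Benabled N t s)
         (fun s => S.schT (decodeSt s) t)
         (Cfire N S t)

/-- The guarded command `GC_body` of the main loop (a choice over all transitions;
the trailing dummy branch has a false guard and probability `0`, hence is
semantically inert). -/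
def GCbody (N : DPN P T V A) (S : Scheduler N) (G : Set (NState P V)) :
    GCmd (PVar P V) (PStep T V) :=
  ((Finset.univ : Finset T).toList.map (branch N S G)).foldr .choice
    (.guard (fun _ => False) (fun _ => 0) skip)

/-- The main loop `C_loop = do GC_body od`. -/
def Cloop (N : DPN P T V A) (S : Scheduler N) (G : Set (NState P V)) :
    Cmd (PVar P V) (PStep T V) :=
  .loop (GCbody N S G)

/-- `C_init`: initialization of the encoded net state. -/
def Cinit (N : DPN P T V A) (st0 : NState P V) : Cmd (PVar P V) (PStep T V) :=
  seqAll (((Finset.univ : Finset P).toList.map fun p =>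
            detAssign (pl p) (fun _ => (st0.1 p : ℚ)))
        ++ ((Finset.univ : Finset V).toList.map fun v =>
            detAssign (unpr v) (fun _ => st0.2 v))
        ++ ((Finset.univ : Finset V).toList.map fun v =>
            detAssign (prm v) (fun _ => st0.2 v)))

/-- The full encoding `C_N = C_init; C_loop`. -/
def CN (N : DPN P T V A) (S : Scheduler N) (G : Set (NState P V)) (st0 : NState P V) :
    Cmd (PVar P V) (PStep T V) :=
  .seq (Cinit N st0) (Cloop N S G)

/-- `𝒢` contains all deadlocked states. -/
def DeadlockedIn (N : DPN P T V A) (G : Set (NState P V)) : Prop :=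
  ∀ st : NState P V, (∀ stp : PStep T V, ¬ Enabled N st stp) → st ∈ G

end

theorem ind_pos {p : Prop} (h : ind p ≠ 0) : p := by
  by_contra hp
  exact h (by simp [ind, hp])

theorem dirac_pos {X : Type*} {a b : X} (h : dirac a b ≠ 0) : b = a := by
  by_contra hp
  exact h (by simp [dirac, hp])

theorem sem_seq_pos {Var Msg : Type} {c1 c2 : Cmd Var Msg} {sl out : PSL Var Msg}
    (h : sem (.seq c1 c2) sl out ≠ 0) :
    ∃ sl', sem c1 sl sl' ≠ 0 ∧ sem c2 sl' out ≠ 0 := by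
  rw [sem] at h
  by_contra hc
  push Not at hc
  apply h
  rw [ENNReal.tsum_eq_zero]
  intro i
  by_cases hi : sem c1 sl i = 0
  · simp [hi]
  · simp [hc i hi]

theorem sem_assign_pos {Var Msg : Type} {x : Var} {D} {sl out : PSL Var Msg}
    (h : sem (.assign x D) sl out ≠ 0) :
    ∃ q, D sl.1 q ≠ 0 ∧ out = (upd sl.1 x q, sl.2) := by
  rw [sem] at h
  by_contra hc
  push Not at hc
  apply h
  rw [ENNReal.tsum_eq_zero]
  intro q
  by_cases hi : D sl.1 q = 0
  · simp [hi]
  · simp [dirac, hc q hi]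

theorem sem_detAssign_pos {Var Msg : Type} {x : Var} {E} {sl out : PSL Var Msg}
    (h : sem (detAssign x E) sl out ≠ 0) :
    out = (upd sl.1 x (E sl.1), sl.2) := by
  obtain ⟨q, hq, ho⟩ := sem_assign_pos h
  have := ind_pos hq
  subst this
  exact ho

theorem sem_observe_pos {Var Msg : Type} {B} {sl out : PSL Var Msg}
    (h : sem (.observe B) sl out ≠ 0) : B sl.1 ∧ out = sl := by
  rw [sem] at h
  exact ⟨ind_pos (left_ne_zero_of_mul h), dirac_pos (right_ne_zero_of_mul h)⟩

theorem sem_log_pos {Var Msg : Type} {m} {sl out : PSL Var Msg}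
    (h : sem (.log m) sl out ≠ 0) : out = (sl.1, sl.2 ++ [m sl.1]) := by
  rw [sem] at h
  exact dirac_pos h

/-- A block of assignments only changes the assigned variables. -/
theorem sem_assigns_frame {Var Msg X : Type} (x : X → Var)
    (D : X → (Var → ℚ) → ℚ → ℝ≥0∞) (l : List X) :
    ∀ (sl out : PSL Var Msg),
      sem (seqAll (l.map fun a => .assign (x a) (D a))) sl out ≠ 0 →
      out.2 = sl.2 ∧ ∀ y, (∀ a ∈ l, y ≠ x a) → out.1 y = sl.1 y := by
  induction l with
  | nil =>
    intro sl out h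
    have := (sem_observe_pos h).2
    subst this
    simp
  | cons a l ih =>
    intro sl out h
    obtain ⟨sl', h1, h2⟩ := sem_seq_pos h
    obtain ⟨q, -, rfl⟩ := sem_assign_pos h1
    obtain ⟨h3, h4⟩ := ih _ _ h2
    refine ⟨h3, fun y hy => ?_⟩
    rw [h4 y fun b hb => hy b (List.mem_cons_of_mem _ hb)]
    simp [upd, hy a List.mem_cons_self]

/-- A block of deterministic independent assignments performs them all. -/
theorem sem_detAssigns {Var Msg X : Type} (x : X → Var) (hx : Function.Injective x)
    (E : X → (Var → ℚ) → ℚ)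
    (hE : ∀ a b, b ≠ a → ∀ s q, E a (upd s (x b) q) = E a s) (l : List X) (hl : l.Nodup) :
    ∀ (sl out : PSL Var Msg),
      sem (seqAll (l.map fun a => detAssign (x a) (E a))) sl out ≠ 0 →
      ∀ a ∈ l, out.1 (x a) = E a sl.1 := by
  induction l with
  | nil => simp
  | cons b l ih =>
    intro sl out h a ha
    obtain ⟨sl', h1, h2⟩ := sem_seq_pos h
    have := sem_detAssign_pos h1
    subst this
    rw [List.nodup_cons] at hl
    by_cases hab : a = b
    · subst hab
      obtain ⟨-, h4⟩ := sem_assigns_frame x (fun a s q => ind (q = E a s)) l _ _ h2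
      rw [h4]
      · simp [upd]
      · intro c hc hxc
        exact hl.1 (hx hxc ▸ hc)
    · have := ih hl.2 _ _ h2 a (by simpa [hab] using ha)
      rw [this]
      exact hE _ _ (Ne.symm hab) _ _

theorem decodeSt_obsState {P V : Type} (st : NState P V) : decodeSt (obsState st) = st := by
  refine Prod.ext ?_ ?_
  · funext p
    simp [decodeSt, decodeM, obsState, pl]
  · funext v
    simp [decodeSt, decodeV, obsState, unpr]

theorem Cfire_pos {P T V A : Type} [Fintype P] [Fintype T] [Fintype V]
    [DecidableEq V] (N : DPN P T V A) (S : Scheduler N) (t : T) (st : NState P V)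
    (ℓ : List (PStep T V)) (out : PSL (PVar P V) (PStep T V))
    (hB : Benabled N t (obsState st))
    (h : sem (Cfire N S t) (obsState st, ℓ) out ≠ 0) :
    ∃ stp st', Fires N st stp st' ∧ out = (obsState st', ℓ ++ [stp]) := by
  obtain ⟨s1, h1, h⟩ := sem_seq_pos h
  obtain ⟨s2, h2, h⟩ := sem_seq_pos h
  obtain ⟨s3, h3, h⟩ := sem_seq_pos h
  obtain ⟨s4, h4, h⟩ := sem_seq_pos h
  obtain ⟨s5, h5, h6⟩ := sem_seq_pos h
  obtain ⟨hpost, rfl⟩ := sem_observe_pos h4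
  have e5 := sem_log_pos h5
  subst e5
  have plinj : Function.Injective (pl : P → PVar P V) := Sum.inl_injective
  have uinj : Function.Injective (unpr : V → PVar P V) :=
    Sum.inr_injective.comp Sum.inl_injective
  have f1 := sem_assigns_frame pl
    (fun p s q => ind (q = s (pl p) - 1)) _ _ _ h1
  have g1 := sem_detAssigns pl plinj (fun p s => s (pl p) - 1)
    (by intro a b hab s q; simp [upd, plinj.eq_iff, Ne.symm hab]) _ (Finset.nodup_toList _) _ _ h1
  have f2 := sem_assigns_frame pl
    (fun p s q => ind (q = s (pl p) + 1)) _ _ _ h2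
  have g2 := sem_detAssigns pl plinj (fun p s => s (pl p) + 1)
    (by intro a b hab s q; simp [upd, plinj.eq_iff, Ne.symm hab]) _ (Finset.nodup_toList _) _ _ h2
  have f3 := sem_assigns_frame prm
    (fun v s q => S.schV (decodeSt s) v q) _ _ _ h3
  have f6 := sem_assigns_frame unpr
    (fun v s q => ind (q = s (prm v))) _ _ _ h6
  have g6 := sem_detAssigns unpr uinj (fun v s => s (prm v))
    (by intro a b hab s q; simp [upd, prm, unpr]) _ (Finset.nodup_toList _) _ _ h6
  simp only [presetL, postsetL, Finset.mem_toList, Finset.mem_filter, Finset.mem_univ,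
    true_and] at f1 g1 f2 g2 f3 f6 g6
  -- marking
  have m1 : ∀ p, s1.1 (pl p) = (st.1 p : ℚ) - if N.flowPT p t then 1 else 0 := by
    intro p
    by_cases hp : N.flowPT p t = true
    · rw [g1 p hp]; simp [hp, obsState, pl]
    · rw [f1.2 (pl p) (fun a ha hpa => hp (plinj hpa ▸ ha))]; simp [hp, obsState, pl]
  have m2 : ∀ p, s2.1 (pl p) = s1.1 (pl p) + if N.flowTP t p then 1 else 0 := by
    intro p
    by_cases hp : N.flowTP t p = true
    · rw [g2 p hp]; simp [hp]
    · rw [f2.2 (pl p) (fun a ha hpa => hp (plinj hpa ▸ ha))]; simp [hp]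
  have mo : ∀ p, out.1 (pl p) = s2.1 (pl p) := by
    intro p
    rw [f6.2 _ (fun a _ => by simp [pl, unpr]), f3.2 _ (fun a _ => by simp [pl, prm])]
  -- unprimed variables
  have u4 : ∀ v, s4.1 (unpr v) = st.2 v := by
    intro v
    rw [f3.2 _ (fun a _ => by simp [unpr, prm]), f2.2 _ (fun a _ => by simp [unpr, pl]),
      f1.2 _ (fun a _ => by simp [unpr, pl])]
    rfl
  have p4 : ∀ v, v ∉ N.writeVars t → s4.1 (prm v) = st.2 v := by
    intro v hv
    rw [f3.2 _ (fun a ha hva => hv ?_), f2.2 _ (fun a _ => by simp [prm, pl]),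
      f1.2 _ (fun a _ => by simp [prm, pl])]
    · rfl
    · have : v = a := by simpa [prm] using hva
      exact this ▸ ha
  have po : ∀ v, out.1 (prm v) = s4.1 (prm v) := by
    intro v
    rw [f6.2 _ (fun a _ => by simp [unpr, prm])]
  have uo : ∀ v, out.1 (unpr v) = s4.1 (prm v) := by
    intro v
    by_cases hv : v ∈ N.writeVars t
    · exact g6 v hv
    · rw [f6.2 (unpr v) (fun a ha hva => hv (uinj hva ▸ ha)), p4 v hv]
      exact u4 v
  have hle : ∀ p, N.flowPT p t = true → 1 ≤ st.1 p := by
    intro p hp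
    have := hB.2 p hp
    simpa [obsState, pl] using this
  have tu : ∀ v ∈ N.readVars t, (getStep N t s4.1).totu v = st.2 v := by
    intro v hv
    simp [getStep, PStep.totu, hv, u4]
  have tp : ∀ v ∈ N.writeVars t, (getStep N t s4.1).totp v = s4.1 (prm v) := by
    intro v hv
    simp [getStep, PStep.totp, hv]
  refine ⟨getStep N t s4.1, _, ⟨⟨⟨?_, ?_, ?_⟩, hle, ?_, ?_⟩, rfl⟩, ?_⟩
  · intro v
    by_cases hv : v ∈ N.readVars t <;> simp [getStep, hv]
  · intro v
    by_cases hv : v ∈ N.writeVars t <;> simp [getStep, hv]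
  · intro v hv
    have hv' : v ∈ N.readVars t := hv
    simp [getStep, hv', u4]
  · exact (N.pre_dep t _ (fun v => obsState st (unpr v)) tu).2 hB.1
  · refine (N.post_dep t _ (fun v => s4.1 (unpr v)) _ (fun v => s4.1 (prm v)) ?_ tp).2 hpost
    intro v hv
    rw [tu v hv, u4]
  · refine Prod.ext ?_ ?_
    · have key : ∀ v, s4.1 (prm v) = fireV N st.2 (getStep N t s4.1) v := by
        intro v
        unfold fireV
        by_cases hv : v ∈ N.writeVars t
        · rw [if_pos (show v ∈ N.writeVars (getStep N t s4.1).tr from hv), tp v hv]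
        · rw [if_neg (show v ∉ N.writeVars (getStep N t s4.1).tr from hv), p4 v hv]
      funext y
      rcases y with p | v | v
      · have := mo p
        rw [m2, m1] at this
        refine this.trans ?_
        show _ = ((fireM N st.1 t p : ℕ) : ℚ)
        unfold fireM
        by_cases hp : N.flowPT p t = true
        · have := hle p hp
          simp only [hp, if_true]
          push_cast [Nat.cast_sub this]
          rfl
        · simp [hp]
      · exact (uo v).trans (key v)
      · exact (po v).trans (key v)
    · rw [f6.1]
      simp [f3.1, f2.1, f1.1]

theorem semGC_foldr_pos {Var Msg X : Type} (b : X → GCmd Var Msg) (g : GCmd Var Msg)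
    (l : List X) (sl out : PSL Var Msg)
    (h : semGC ((l.map b).foldr .choice g) sl out ≠ 0) :
    (∃ a, semGC (b a) sl out ≠ 0) ∨ semGC g sl out ≠ 0 := by
  induction l with
  | nil => exact Or.inr h
  | cons a l ih =>
    simp only [List.map_cons, List.foldr_cons] at h
    rw [semGC] at h
    by_cases ha : semGC (b a) sl out = 0
    · rw [ha, zero_add] at h
      exact ih h
    · exact Or.inl ⟨a, ha⟩

theorem GCbody_pos {P T V A : Type} [Fintype P] [Fintype T] [Fintype V]
    [DecidableEq V] (N : DPN P T V A) (S : Scheduler N) (G : Set (NState P V))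
    (st : NState P V) (ℓ : List (PStep T V)) (out : PSL (PVar P V) (PStep T V))
    (h : semGC (GCbody N S G) (obsState st, ℓ) out ≠ 0) :
    st ∉ G ∧ ∃ stp st', Fires N st stp st' ∧ out = (obsState st', ℓ ++ [stp]) := by
  rcases semGC_foldr_pos _ _ _ _ _ h with ⟨t, ht⟩ | h0
  · rw [branch, semGC] at ht
    obtain ⟨hg, hB⟩ := ind_pos (left_ne_zero_of_mul (left_ne_zero_of_mul ht))
    simp only [decodeSt_obsState] at hg
    exact ⟨hg, Cfire_pos N S t st ℓ out hB (right_ne_zero_of_mul ht)⟩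
  · rw [semGC] at h0
    simp at h0

theorem iter_pos {P T V A : Type} [Fintype P] [Fintype T] [Fintype V]
    [DecidableEq V] (N : DPN P T V A) (S : Scheduler N) (G : Set (NState P V)) (n : ℕ) :
    ∀ (st : NState P V) (ℓ : List (PStep T V)) (out : PSL (PVar P V) (PStep T V)),
      unroll (GCbody N S G) n (obsState st, ℓ) out ≠ 0 →
      ∃ σ st', out = (obsState st', ℓ ++ σ) ∧ RunsTo N st σ st' ∧
        ∀ k, k < σ.length → ∀ st'', RunsTo N st (σ.take k) st'' → st'' ∉ G := by
  induction n with
  | zero => intro st ℓ out h; exact absurd rfl h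
  | succ n ih =>
    intro st ℓ out h
    rw [unroll, iter] at h
    by_cases h1 : dirac ((obsState st, ℓ) : PSL (PVar P V) (PStep T V)) out = 0
    · rw [h1, mul_zero, zero_add, Ne, ENNReal.tsum_eq_zero] at h
      push Not at h
      obtain ⟨sl', h⟩ := h
      obtain ⟨hg, stp, st1, hf, rfl⟩ :=
        GCbody_pos N S G st ℓ _ (right_ne_zero_of_mul (left_ne_zero_of_mul h))
      obtain ⟨σ, st', rfl, hr, hk⟩ := ih _ _ _ (right_ne_zero_of_mul h)
      refine ⟨stp :: σ, st', by simp, ⟨st1, hf, hr⟩, ?_⟩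
      intro k hkl st'' hrun
      cases k with
      | zero =>
        have : st'' = st := hrun
        exact this ▸ hg
      | succ k =>
        obtain ⟨st2, hf2, hrun⟩ := hrun
        have : st2 = st1 := hf2.2.trans hf.2.symm
        subst this
        exact hk k (by simpa using hkl) st'' hrun
    · exact ⟨[], st, by simpa using dirac_pos h1, rfl, by simp⟩

/-- Lemma 4: if `⟦C_loop⟧(s_{M₀,α₀}, ε)(s,σ) > 0`, then
`σ ∈ Runs(M₀,α₀,𝒢)`, `s` is observable, and `(M₀,α₀) —σ→ (M_s,α_s)` for the
marking `M_s` and valuation `α_s` decoded from `s`. -/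
theorem loop_pos_legal {P T V A : Type} [Fintype P] [Fintype T] [Fintype V]
    [DecidableEq V] (N : DPN P T V A) (S : Scheduler N) (G : Set (NState P V))
    (hG : DeadlockedIn N G) (st0 : NState P V)
    (out : PSL (PVar P V) (PStep T V))
    (h : 0 < sem (Cloop N S G) (obsState st0, ([] : List (PStep T V))) out) :
    InRuns N G st0 out.2 ∧ Observable out.1 ∧
      ∃ M' : P → ℕ, (∀ p : P, (M' p : ℚ) = out.1 (pl p)) ∧
        RunsTo N st0 out.2 (M', decodeV out.1) := by
  rw [Cloop, sem, lt_iSup_iff] at h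
  obtain ⟨n, hn⟩ := h
  obtain ⟨σ, st', rfl, hr, hk⟩ := iter_pos N S G n st0 [] out hn.ne'
  refine ⟨fun k _ hkl st'' hrun => hk k (by simpa using hkl) st'' (by simpa using hrun),
    fun v => rfl, st'.1, fun p => rfl, ?_⟩
  exact List.nil_append σ ▸ hr
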